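/- If a new hyperplane H (not in A) in ℚ(ζ)³ contains no 1-dimensional intersection point of the 27-hyperplane arrangement A, then the restriction of A ∪ {H} to H has exactly 27 elements; if H contains exactly one such point p, then |(A ∪ {H})^H| = 27 - |A_p| + 1 ≥ 21. -/

import Mathlib

open Module Matrix
open scoped Classical

namespace Arrgt

variable {K : Type*} [Field K]

/-- A (central) hyperplane arrangement in `K^n`: a finite set of kernels of
nonzero linear forms. -/
structure Arrangement (K : Type*) [Field K] (n : ℕ) where
  hyperplanes : Finset (Submodule K (Fin n → K))
  isHyp : ∀ H ∈ hyperplanes, ∃ f : (Fin n → K) →ₗ[K] K, f ≠ 0 ∧ H = LinearMap.ker f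

/-- The deletion `A \ {H}`. -/
noncomputable def Arrangement.delete {n : ℕ} (A : Arrangement K n) (H : Submodule K (Fin n → K)) :
    Arrangement K n :=
  ⟨A.hyperplanes.erase H, fun H' hH' => A.isHyp H' (Finset.mem_of_mem_erase hH')⟩

/-- The empty arrangement of rank `n`. -/
def emptyArr (K : Type*) [Field K] (n : ℕ) : Arrangement K n := ⟨∅, by simp⟩

/-- The linear polynomial in `K[x_1,...,x_n]` attached to a linear form. -/
noncomputable def linPoly {n : ℕ} (f : (Fin n → K) →ₗ[K] K) : MvPolynomial (Fin n) K :=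
  ∑ i, MvPolynomial.C (f (Pi.single i 1)) * MvPolynomial.X i

/-- `Q` is a defining polynomial of the arrangement `A`: a product of linear forms
whose kernels are exactly the hyperplanes of `A`. -/
def IsDefiningPoly {n : ℕ} (A : Arrangement K n) (Q : MvPolynomial (Fin n) K) : Prop :=
  ∃ α : Submodule K (Fin n → K) → ((Fin n → K) →ₗ[K] K),
    (∀ H ∈ A.hyperplanes, α H ≠ 0 ∧ LinearMap.ker (α H) = H) ∧
    Q = ∏ H ∈ A.hyperplanes, linPoly (α H)

/-- Evaluation of a derivation at the polynomial `Q`, as a linear map. -/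
noncomputable def evalDer {n : ℕ} (Q : MvPolynomial (Fin n) K) :
    Derivation K (MvPolynomial (Fin n) K) (MvPolynomial (Fin n) K) →ₗ[MvPolynomial (Fin n) K]
      MvPolynomial (Fin n) K where
  toFun θ := θ Q
  map_add' _ _ := rfl
  map_smul' _ _ := rfl

/-- The module `D(A) = {θ : θ(Q) ∈ Q·S}` of `A`-derivations (for a chosen defining
polynomial `Q`). -/
noncomputable def DerModule {n : ℕ} (Q : MvPolynomial (Fin n) K) :
    Submodule (MvPolynomial (Fin n) K)
      (Derivation K (MvPolynomial (Fin n) K) (MvPolynomial (Fin n) K)) :=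
  Submodule.comap (evalDer Q) (Ideal.span {Q})

/-- `A` is a free arrangement: `D(A)` is a free module over `S = K[x_1,...,x_n]`. -/
def IsFree {n : ℕ} (A : Arrangement K n) : Prop :=
  ∃ Q, IsDefiningPoly A Q ∧ Module.Free (MvPolynomial (Fin n) K) (DerModule Q)

/-- A nonzero derivation is homogeneous of polynomial degree `p` if all its
coefficients are homogeneous of degree `p`. -/
def IsHomogeneousDer {n : ℕ}
    (θ : Derivation K (MvPolynomial (Fin n) K) (MvPolynomial (Fin n) K)) (p : ℕ) : Prop :=
  θ ≠ 0 ∧ ∀ i, (θ (MvPolynomial.X i)).IsHomogeneous p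

/-- `A` is free with exponents the multiset `e`: `D(A)` has a homogeneous basis whose
polynomial degrees form the multiset `e`. -/
def HasExponents {n : ℕ} (A : Arrangement K n) (e : Multiset ℕ) : Prop :=
  ∃ Q, IsDefiningPoly A Q ∧
    ∃ (l : List ℕ) (b : Basis (Fin l.length) (MvPolynomial (Fin n) K) (DerModule Q)),
      (l : Multiset ℕ) = e ∧ ∀ i : Fin l.length, IsHomogeneousDer ((b i : DerModule Q) :
        Derivation K (MvPolynomial (Fin n) K) (MvPolynomial (Fin n) K)) (l.get i)

/-- `B` is (a model, via a linear identification `H ≅ K^n`, of) the restriction `A^H`. -/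
def IsRestriction {n : ℕ} (A : Arrangement K (n + 1)) (H : Submodule K (Fin (n + 1) → K))
    (B : Arrangement K n) : Prop :=
  ∃ e : H ≃ₗ[K] (Fin n → K),
    B.hyperplanes = (A.hyperplanes.erase H).image
      (fun H' => Submodule.map (e : H →ₗ[K] (Fin n → K)) (H'.comap H.subtype))

variable (K) in
/-- The class of inductively free arrangements. -/
inductive InductivelyFree : {n : ℕ} → Arrangement K n → Prop
  | empty (n : ℕ) : InductivelyFree (emptyArr K n)
  | add {n : ℕ} (A : Arrangement K (n + 1)) (H : Submodule K (Fin (n + 1) → K))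
      (hH : H ∈ A.hyperplanes) (B : Arrangement K n) (hB : IsRestriction A H B)
      (e' e'' : Multiset ℕ)
      (h1 : InductivelyFree (A.delete H)) (h2 : InductivelyFree B)
      (h3 : HasExponents (A.delete H) e') (h4 : HasExponents B e'')
      (h5 : e'' ≤ e') : InductivelyFree A

variable (K) in
/-- The class of recursively free arrangements. -/
inductive RecursivelyFree : {n : ℕ} → Arrangement K n → Prop
  | empty (n : ℕ) : RecursivelyFree (emptyArr K n)
  | add {n : ℕ} (A : Arrangement K (n + 1)) (H : Submodule K (Fin (n + 1) → K))
      (hH : H ∈ A.hyperplanes) (B : Arrangement K n) (hB : IsRestriction A H B)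
      (e' e'' : Multiset ℕ)
      (h1 : RecursivelyFree (A.delete H)) (h2 : RecursivelyFree B)
      (h3 : HasExponents (A.delete H) e') (h4 : HasExponents B e'')
      (h5 : e'' ≤ e') : RecursivelyFree A
  | del {n : ℕ} (A : Arrangement K (n + 1)) (H : Submodule K (Fin (n + 1) → K))
      (hH : H ∈ A.hyperplanes) (B : Arrangement K n) (hB : IsRestriction A H B)
      (e e'' : Multiset ℕ)
      (h1 : RecursivelyFree A) (h2 : RecursivelyFree B)
      (h3 : HasExponents A e) (h4 : HasExponents B e'')
      (h5 : e'' ≤ e) : RecursivelyFree (A.delete H)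

/-- The intersection lattice of a set of hyperplanes: all intersections of finite
subsets (including the ambient space `⊤` as the empty intersection). -/
def setLattice {n : ℕ} (𝓐 : Set (Submodule K (Fin n → K))) : Set (Submodule K (Fin n → K)) :=
  {X | ∃ s : Finset (Submodule K (Fin n → K)), ↑s ⊆ 𝓐 ∧ X = s.inf id}

/-- The intersection lattice of an arrangement. -/
def Arrangement.lattice {n : ℕ} (A : Arrangement K n) : Set (Submodule K (Fin n → K)) :=
  setLattice (↑A.hyperplanes)

/-- The linear form `x ↦ ∑ v i * x i` attached to a normal vector `v`. -/
noncomputable def lf {n : ℕ} (v : Fin n → K) : (Fin n → K) →ₗ[K] K :=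
  ∑ i, v i • LinearMap.proj i

lemma lf_single {n : ℕ} (v : Fin n → K) (j : Fin n) : lf v (Pi.single j 1) = v j := by
  simp [lf, Pi.single_apply, mul_ite, Finset.sum_ite_eq']

lemma lf_ne_zero {n : ℕ} {v : Fin n → K} (hv : v ≠ 0) : lf v ≠ 0 := by
  intro h
  apply hv
  funext j
  have := congrArg (fun f : (Fin n → K) →ₗ[K] K => f (Pi.single j 1)) h
  simpa [lf_single] using this

/-- The hyperplane `v^⊥` with normal vector `v`. -/
noncomputable def perp {n : ℕ} (v : Fin n → K) : Submodule K (Fin n → K) :=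
  LinearMap.ker (lf v)

/-- Build an arrangement from a finite set of nonzero normal vectors. -/
noncomputable def mkArr {n : ℕ} (vs : Finset (Fin n → K)) (h : (0 : Fin n → K) ∉ vs) :
    Arrangement K n :=
  ⟨vs.image perp, by
    intro H hH
    obtain ⟨v, hv, rfl⟩ := Finset.mem_image.mp hH
    exact ⟨lf v, lf_ne_zero (fun h0 => h (h0 ▸ hv)), rfl⟩⟩

end Arrgt

namespace Arrgt

variable {K : Type*} [Field K]

/-- The ring `ℤ[X] / (X⁴ + X³ + X² + X + 1)`, in coordinates with respect to `1, X, X², X³`. -/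
@[ext]
structure CycInt where
  a : ℤ
  b : ℤ
  c : ℤ
  d : ℤ
  deriving DecidableEq

namespace CycInt

instance : Zero CycInt := ⟨⟨0, 0, 0, 0⟩⟩
instance : One CycInt := ⟨⟨1, 0, 0, 0⟩⟩
instance : Add CycInt := ⟨fun x y => ⟨x.a + y.a, x.b + y.b, x.c + y.c, x.d + y.d⟩⟩
instance : Neg CycInt := ⟨fun x => ⟨-x.a, -x.b, -x.c, -x.d⟩⟩
instance : Mul CycInt := ⟨fun x y =>
  ⟨x.a * y.a + x.c * y.d + x.d * y.c - (x.b * y.d + x.c * y.c + x.d * y.b),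
   x.a * y.b + x.b * y.a + x.d * y.d - (x.b * y.d + x.c * y.c + x.d * y.b),
   x.a * y.c + x.b * y.b + x.c * y.a - (x.b * y.d + x.c * y.c + x.d * y.b),
   x.a * y.d + x.b * y.c + x.c * y.b + x.d * y.a - (x.b * y.d + x.c * y.c + x.d * y.b)⟩⟩

lemma zero_def : (0 : CycInt) = ⟨0, 0, 0, 0⟩ := rfl
lemma one_def : (1 : CycInt) = ⟨1, 0, 0, 0⟩ := rfl
lemma add_def (x y : CycInt) : x + y = ⟨x.a + y.a, x.b + y.b, x.c + y.c, x.d + y.d⟩ := rfl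
lemma neg_def (x : CycInt) : -x = ⟨-x.a, -x.b, -x.c, -x.d⟩ := rfl
lemma mul_def (x y : CycInt) : x * y =
  ⟨x.a * y.a + x.c * y.d + x.d * y.c - (x.b * y.d + x.c * y.c + x.d * y.b),
   x.a * y.b + x.b * y.a + x.d * y.d - (x.b * y.d + x.c * y.c + x.d * y.b),
   x.a * y.c + x.b * y.b + x.c * y.a - (x.b * y.d + x.c * y.c + x.d * y.b),
   x.a * y.d + x.b * y.c + x.c * y.b + x.d * y.a - (x.b * y.d + x.c * y.c + x.d * y.b)⟩ := rfl

instance : CommRing CycInt where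
  add_assoc x y z := by ext <;> simp only [add_def] <;> ring
  zero_add x := by ext <;> simp [add_def, zero_def]
  add_zero x := by ext <;> simp [add_def, zero_def]
  add_comm x y := by ext <;> simp only [add_def] <;> ring
  neg_add_cancel x := by ext <;> simp [add_def, neg_def, zero_def]
  mul_assoc x y z := by ext <;> simp only [mul_def] <;> ring
  one_mul x := by ext <;> simp [mul_def, one_def]
  mul_one x := by ext <;> simp [mul_def, one_def]
  zero_mul x := by ext <;> simp [mul_def, zero_def]
  mul_zero x := by ext <;> simp [mul_def, zero_def]
  left_distrib x y z := by ext <;> simp only [mul_def, add_def] <;> ring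
  right_distrib x y z := by ext <;> simp only [mul_def, add_def] <;> ring
  mul_comm x y := by ext <;> simp only [mul_def] <;> ring
  nsmul := nsmulRec
  zsmul := zsmulRec

/-- The ring homomorphism to `S` sending the generator to a root `z` of the fifth cyclotomic
polynomial. -/
def eval {S : Type*} [CommRing S] (z : S) (hz : z ^ 4 + z ^ 3 + z ^ 2 + z + 1 = 0) :
    CycInt →+* S where
  toFun x := x.a + x.b * z + x.c * z ^ 2 + x.d * z ^ 3
  map_zero' := by simp [zero_def]
  map_one' := by simp [one_def]
  map_add' x y := by simp only [add_def]; push_cast; ring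
  map_mul' x y := by
    simp only [mul_def]
    push_cast
    linear_combination (-(x.b * y.d + x.c * y.c + x.d * y.b : S)
      - (x.c * y.d + x.d * y.c) * (z - 1) - x.d * y.d * (z ^ 2 - z)) * hz

lemma eval_apply {S : Type*} [CommRing S] (z : S) (hz : z ^ 4 + z ^ 3 + z ^ 2 + z + 1 = 0)
    (x : CycInt) : eval z hz x = x.a + x.b * z + x.c * z ^ 2 + x.d * z ^ 3 := rfl

open Polynomial in
lemma eval_injective {ζ : ℂ} (hζ : IsPrimitiveRoot ζ 5)
    (hz : ζ ^ 4 + ζ ^ 3 + ζ ^ 2 + ζ + 1 = 0) : Function.Injective (eval ζ hz) := by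
  rw [injective_iff_map_eq_zero]
  intro x hx
  rw [eval_apply] at hx
  set P : ℤ[X] := C x.a + C x.b * X + C x.c * X ^ 2 + C x.d * X ^ 3 with hP
  have hroot : aeval ζ P = 0 := by simpa [hP] using hx
  have hdvd : cyclotomic 5 ℤ ∣ P := by
    rw [cyclotomic_eq_minpoly hζ (by norm_num)]
    exact minpoly.isIntegrallyClosed_dvd (hζ.isIntegral (by norm_num)) hroot
  have hdeg : P.degree < (cyclotomic 5 ℤ).degree := by
    rw [degree_cyclotomic, Nat.totient_prime (by norm_num)]
    refine lt_of_le_of_lt (b := (3 : WithBot ℕ)) ?_ (by norm_num)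
    rw [hP]; compute_degree
  have h0 : P = 0 := eq_zero_of_dvd_of_degree_lt hdvd hdeg
  have hc (n : ℕ) : P.coeff n = 0 := by rw [h0, coeff_zero]
  have h_0 := hc 0
  have h_1 := hc 1
  have h_2 := hc 2
  have h_3 := hc 3
  simp only [hP, coeff_add, coeff_C_mul, coeff_X, coeff_C, coeff_X_pow] at h_0 h_1 h_2 h_3
  norm_num at h_0 h_1 h_2 h_3
  ext <;> assumption

end CycInt

/-- The determinant of the matrix with rows `u`, `v`, `w`. -/
def tripleDet {S : Type*} [CommRing S] (u v w : Fin 3 → S) : S :=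
  u 0 * (v 1 * w 2 - v 2 * w 1) - u 1 * (v 0 * w 2 - v 2 * w 0) + u 2 * (v 0 * w 1 - v 1 * w 0)

lemma map_tripleDet {S T : Type*} [CommRing S] [CommRing T] (φ : S →+* T) (u v w : Fin 3 → S) :
    φ (tripleDet u v w) = tripleDet (φ ∘ u) (φ ∘ v) (φ ∘ w) := by
  simp [tripleDet]

lemma lf_apply {n : ℕ} (v x : Fin n → K) : lf v x = v ⬝ᵥ x := by
  simp [lf, dotProduct]

lemma mem_perp {n : ℕ} {v x : Fin n → K} : x ∈ perp v ↔ v ⬝ᵥ x = 0 := by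
  rw [perp, LinearMap.mem_ker, lf_apply]

lemma tripleDet_eq_zero {u v w x : Fin 3 → K} (hx : x ≠ 0) (hu : x ∈ perp u) (hv : x ∈ perp v)
    (hw : x ∈ perp w) : tripleDet u v w = 0 := by
  have h : (Matrix.of ![u, v, w]).det = 0 := by
    refine Matrix.exists_mulVec_eq_zero_iff.mp ⟨x, hx, ?_⟩
    funext i
    fin_cases i
    exacts [mem_perp.mp hu, mem_perp.mp hv, mem_perp.mp hw]
  rw [Matrix.det_fin_three] at h
  simp only [Matrix.of_apply, Matrix.cons_val] at h
  rw [tripleDet]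
  linear_combination h

lemma perp_le_perp {n : ℕ} {u v : Fin n → K} (hu : u ≠ 0) (h : ∀ i j, u i * v j = u j * v i) :
    perp u ≤ perp v := by
  intro x hx
  rw [mem_perp] at hx ⊢
  obtain ⟨i, hi⟩ := Function.ne_iff.mp hu
  refine (mul_eq_zero.mp ?_).resolve_left hi
  calc u i * (v ⬝ᵥ x) = v i * (u ⬝ᵥ x) := by
        simp only [dotProduct, Finset.mul_sum]
        exact Finset.sum_congr rfl fun j _ => by linear_combination x j * h i j
    _ = 0 := by rw [hx, mul_zero]

lemma perp_eq_perp {n : ℕ} {u v : Fin n → K} (hu : u ≠ 0) (hv : v ≠ 0)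
    (h : ∀ i j, u i * v j = u j * v i) : perp u = perp v :=
  le_antisymm (perp_le_perp hu h) (perp_le_perp hv fun i j => by linear_combination -h i j)

lemma perp_vecMul {n : ℕ} (v : Fin n → K) (M : Matrix (Fin n) (Fin n) K) :
    perp (v ᵥ* M) = (perp v).comap M.mulVecLin := by
  ext x
  simp [mem_perp, Matrix.dotProduct_mulVec]

lemma finrank_ker_of_ne_zero {f : (Fin 3 → K) →ₗ[K] K} (hf : f ≠ 0) :
    finrank K (LinearMap.ker f) = 2 := by
  have h := Module.Dual.finrank_ker_add_one_of_ne_zero (f := f) hf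
  rw [Module.finrank_fin_fun] at h
  omega

lemma finrank_inf_ge {H H' : Submodule K (Fin 3 → K)} (hH : finrank K H = 2)
    (hH' : finrank K H' = 2) : 1 ≤ finrank K ↥(H ⊓ H') := by
  have h := Submodule.finrank_sup_add_finrank_inf_eq H H'
  have h' := (H ⊔ H').finrank_le
  rw [Module.finrank_fin_fun] at h'
  omega

lemma finrank_inf_eq_one {H H' : Submodule K (Fin 3 → K)} (hH : finrank K H = 2)
    (hH' : finrank K H' = 2) (hne : H ≠ H') : finrank K ↥(H ⊓ H') = 1 := by
  refine le_antisymm ?_ (finrank_inf_ge hH hH')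
  by_contra! h
  have h1 : H ⊓ H' = H := Submodule.eq_of_le_of_finrank_le inf_le_left (by omega)
  have h2 : H ⊓ H' = H' := Submodule.eq_of_le_of_finrank_le inf_le_right (by omega)
  exact hne (h1.symm.trans h2)

/-- Two planes with the same trace on a further plane `H₀` meet in that trace. -/
lemma inf_eq_of_trace_eq {H₀ H H' : Submodule K (Fin 3 → K)} (h₀ : finrank K H₀ = 2)
    (hH : finrank K H = 2) (hH' : finrank K H' = 2) (hne₀ : H₀ ≠ H) (hne : H ≠ H')
    (h : H₀ ⊓ H = H₀ ⊓ H') : H ⊓ H' = H₀ ⊓ H := by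
  refine (Submodule.eq_of_le_of_finrank_eq (le_inf inf_le_right (h ▸ inf_le_right)) ?_).symm
  rw [finrank_inf_eq_one h₀ hH hne₀, finrank_inf_eq_one hH hH' hne]

lemma inf_mem_setLattice {n : ℕ} {𝓐 : Set (Submodule K (Fin n → K))}
    {H H' : Submodule K (Fin n → K)} (hH : H ∈ 𝓐) (hH' : H' ∈ 𝓐) : H ⊓ H' ∈ setLattice 𝓐 :=
  ⟨{H, H'}, by simp [Set.insert_subset_iff, hH, hH'], by simp⟩

section Restriction

variable {𝓐 : Set (Submodule K (Fin 3 → K))} {H₀ : Submodule K (Fin 3 → K)}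

/-- If `H₀` contains no point of the lattice of `𝓐`, the traces on `H₀` are all distinct. -/
lemma ncard_trace_of_no_point (h𝓐 : ∀ H ∈ 𝓐, finrank K H = 2) (h₀ : finrank K H₀ = 2)
    (hH₀ : H₀ ∉ 𝓐) (hp : {p ∈ setLattice 𝓐 | finrank K p = 1 ∧ p ≤ H₀} = ∅) :
    ((fun H' => H₀ ⊓ H') '' 𝓐).ncard = 𝓐.ncard := by
  refine Set.InjOn.ncard_image fun H hH H' hH' h => ?_
  by_contra hne
  have hne₀ : H₀ ≠ H := fun e => hH₀ (e ▸ hH)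
  have heq := inf_eq_of_trace_eq h₀ (h𝓐 H hH) (h𝓐 H' hH') hne₀ hne h
  refine Set.eq_empty_iff_forall_notMem.mp hp (H ⊓ H') ⟨inf_mem_setLattice hH hH', ?_, ?_⟩
  · exact finrank_inf_eq_one (h𝓐 H hH) (h𝓐 H' hH') hne
  · exact heq ▸ inf_le_left

/-- If `H₀` contains exactly one point `p₀` of the lattice of `𝓐`, then precisely the planes
through `p₀` have the same trace on `H₀`. -/
lemma ncard_trace_of_unique_point (hfin : 𝓐.Finite) (h𝓐 : ∀ H ∈ 𝓐, finrank K H = 2)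
    (h₀ : finrank K H₀ = 2) (hH₀ : H₀ ∉ 𝓐) {p₀ : Submodule K (Fin 3 → K)}
    (hp : {p ∈ setLattice 𝓐 | finrank K p = 1 ∧ p ≤ H₀} = {p₀}) :
    ((fun H' => H₀ ⊓ H') '' 𝓐).ncard = 𝓐.ncard - {H ∈ 𝓐 | p₀ ≤ H}.ncard + 1 := by
  obtain ⟨⟨s, hs, hps⟩, hp1, hpH₀⟩ : p₀ ∈ {p ∈ setLattice 𝓐 | finrank K p = 1 ∧ p ≤ H₀} :=
    hp ▸ rfl
  set B := {H ∈ 𝓐 | p₀ ≤ H} with hB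
  have hBA : B ⊆ 𝓐 := fun H hH => hH.1
  have hBne : B.Nonempty := by
    obtain rfl | ⟨H, hH⟩ := s.eq_empty_or_nonempty
    · rw [hps, Finset.inf_empty, finrank_top, Module.finrank_fin_fun] at hp1
      omega
    · exact ⟨H, hs hH, hps ▸ Finset.inf_le hH⟩
  have hne₀ {H} (hH : H ∈ 𝓐) : H₀ ≠ H := fun e => hH₀ (e ▸ hH)
  have htrace {H} (hH : H ∈ 𝓐) : finrank K ↥(H₀ ⊓ H) = 1 :=
    finrank_inf_eq_one h₀ (h𝓐 H hH) (hne₀ hH)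
  have hiff {H} (hH : H ∈ 𝓐) : H₀ ⊓ H = p₀ ↔ p₀ ≤ H :=
    ⟨fun e => e ▸ inf_le_right, fun hle =>
      (Submodule.eq_of_le_of_finrank_eq (le_inf hpH₀ hle) (by rw [hp1, htrace hH])).symm⟩
  have himage : (fun H' => H₀ ⊓ H') '' 𝓐 = insert p₀ ((fun H' => H₀ ⊓ H') '' (𝓐 \ B)) := by
    ext X
    constructor
    · rintro ⟨H, hH, rfl⟩
      by_cases hX : p₀ ≤ H
      · exact Or.inl ((hiff hH).mpr hX)
      · exact Or.inr ⟨H, ⟨hH, fun h => hX h.2⟩, rfl⟩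
    · rintro (rfl | ⟨H, hH, rfl⟩)
      · obtain ⟨H, hH⟩ := hBne
        exact ⟨H, hH.1, (hiff hH.1).mpr hH.2⟩
      · exact ⟨H, hH.1, rfl⟩
  have hnotMem : p₀ ∉ (fun H' => H₀ ⊓ H') '' (𝓐 \ B) := by
    rintro ⟨H, hH, e⟩
    exact hH.2 ⟨hH.1, (hiff hH.1).mp e⟩
  have hinj : Set.InjOn (fun H' => H₀ ⊓ H') (𝓐 \ B) := by
    intro H hH H' hH' h
    by_contra hne
    have heq := inf_eq_of_trace_eq h₀ (h𝓐 H hH.1) (h𝓐 H' hH'.1) (hne₀ hH.1) hne h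
    have hmem : H ⊓ H' ∈ ({p₀} : Set (Submodule K (Fin 3 → K))) := hp ▸
      ⟨inf_mem_setLattice hH.1 hH'.1, finrank_inf_eq_one (h𝓐 H hH.1) (h𝓐 H' hH'.1) hne,
        heq ▸ inf_le_left⟩
    exact hH.2 ⟨hH.1, (Set.mem_singleton_iff.mp hmem) ▸ inf_le_left⟩
  rw [himage, Set.ncard_insert_of_notMem hnotMem ((hfin.subset Set.sdiff_subset).image _),
    hinj.ncard_image, Set.ncard_sdiff hBA (hfin.subset hBA)]

end Restriction

/-- The action of the three generating reflections of `H₃` on row vectors. -/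
def reflect {S : Type*} [CommRing S] (τ : S) (k : Fin 3) (v : Fin 3 → S) : Fin 3 → S :=
  ![![v 0, v 1, v 1 - v 2], ![-v 0 + τ * v 1, v 1, v 2], ![v 0, τ * v 0 - v 1 + v 2, v 2]] k

lemma map_reflect {S T : Type*} [CommRing S] [CommRing T] (φ : S →+* T) (τ : S) (k : Fin 3)
    (v : Fin 3 → S) : φ ∘ reflect τ k v = reflect (φ τ) k (φ ∘ v) := by
  funext i
  fin_cases k <;> fin_cases i <;> simp [reflect]

lemma reflect_reflect {S : Type*} [CommRing S] (τ : S) (k : Fin 3) (v : Fin 3 → S) :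
    reflect τ k (reflect τ k v) = v := by
  funext i
  fin_cases k <;> fin_cases i <;> simp [reflect] <;> ring

/-- Normal vectors of the 27 planes. Each one is, up to a scalar, the image under a generating
reflection of an earlier one or one of the first four. -/
def normal : Fin 27 → Fin 3 → CycInt :=
  ![![⟨1, 0, 0, 0⟩, ⟨0, 0, 0, 0⟩, ⟨0, 0, 0, 0⟩],
    ![⟨0, 0, 0, 0⟩, ⟨1, 0, 0, 0⟩, ⟨0, 0, 0, 0⟩],
    ![⟨0, 0, 0, 0⟩, ⟨0, 0, 0, 0⟩, ⟨1, 0, 0, 0⟩],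
    ![⟨1, 0, 0, 0⟩, ⟨0, 0, -1, 0⟩, ⟨0, 0, 0, 0⟩],
    ![⟨1, 0, 0, 0⟩, ⟨0, 0, -1, -1⟩, ⟨0, 0, 0, 0⟩],
    ![⟨0, 0, 0, 0⟩, ⟨1, 0, 0, 0⟩, ⟨1, 0, 0, 0⟩],
    ![⟨1, 1, 0, 0⟩, ⟨0, 0, 0, -1⟩, ⟨0, 0, 0, 0⟩],
    ![⟨1, 0, 0, 0⟩, ⟨0, 0, -1, 0⟩, ⟨0, 0, -1, 0⟩],
    ![⟨1, 0, 0, 0⟩, ⟨0, 0, 0, -1⟩, ⟨0, 0, 0, 0⟩],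
    ![⟨1, 0, 0, 0⟩, ⟨0, 0, -1, -1⟩, ⟨0, 0, -1, -1⟩],
    ![⟨1, 1, 0, 0⟩, ⟨1, 1, 0, 0⟩, ⟨0, 0, 0, 0⟩],
    ![⟨1, 1, 0, 0⟩, ⟨0, 0, 0, -1⟩, ⟨0, 0, 0, -1⟩],
    ![⟨1, 0, 0, 0⟩, ⟨0, 0, 0, -1⟩, ⟨0, 0, 0, -1⟩],
    ![⟨1, 0, 0, 0⟩, ⟨0, 0, -1, -1⟩, ⟨0, 0, -1, 0⟩],
    ![⟨1, 1, 0, 0⟩, ⟨1, 1, 0, 0⟩, ⟨1, 1, 0, 0⟩],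
    ![⟨1, 1, 0, 0⟩, ⟨1, 1, 0, -1⟩, ⟨0, 0, 0, -1⟩],
    ![⟨1, 0, 0, 0⟩, ⟨0, 0, -1, -1⟩, ⟨0, 0, 0, -1⟩],
    ![⟨1, 1, 0, 0⟩, ⟨1, 1, 0, 0⟩, ⟨1, 0, 0, 0⟩],
    ![⟨1, 1, 0, 0⟩, ⟨1, 1, 0, -1⟩, ⟨1, 1, 0, 0⟩],
    ![⟨1, 1, 0, -1⟩, ⟨1, 1, 0, -1⟩, ⟨0, 0, 0, -1⟩],
    ![⟨1, 1, 0, 0⟩, ⟨1, 1, 0, 0⟩, ⟨0, 1, 0, 0⟩],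
    ![⟨1, 1, 0, 0⟩, ⟨1, 0, 0, -1⟩, ⟨1, 0, 0, 0⟩],
    ![⟨1, 1, 0, -1⟩, ⟨1, 1, 0, -1⟩, ⟨1, 1, 0, 0⟩],
    ![⟨1, 1, 0, 0⟩, ⟨0, 1, 0, -1⟩, ⟨0, 1, 0, 0⟩],
    ![⟨1, 1, 0, 0⟩, ⟨1, 0, 0, -1⟩, ⟨0, 0, 0, -1⟩],
    ![⟨1, 1, 0, 0⟩, ⟨0, 1, 0, -1⟩, ⟨0, 0, 0, -1⟩],
    ![⟨1, 1, 0, -1⟩, ⟨2, 2, 0, 0⟩, ⟨1, 1, 0, 0⟩]]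

/-- The image `-X² - X³` of the golden ratio. -/
def tau : CycInt := ⟨0, 0, -1, -1⟩

/-- Being proportional, for nonzero vectors. -/
abbrev Proportional {S : Type*} [CommRing S] (u v : Fin 3 → S) : Prop :=
  u ≠ 0 ∧ ∀ i j, u i * v j = u j * v i

lemma exists_proportional_reflect :
    ∀ i k, ∃ j, Proportional (reflect tau k (normal i)) (normal j) := by
  decide +kernel

lemma proportional_reflect_of_lt :
    ∀ i : Fin 27, 4 ≤ i → ∃ j < i, ∃ k, Proportional (reflect tau k (normal j)) (normal i) := by
  decide +kernel

lemma normal_ne_zero : ∀ i, normal i ≠ 0 := by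
  decide +kernel

/-- The normal vectors with `X` replaced by `2`, a root of the fifth cyclotomic polynomial mod `31`. -/
def normalInt (i : Fin 27) (j : Fin 3) : ℤ :=
  (normal i j).a + (normal i j).b * 2 + (normal i j).c * 4 + (normal i j).d * 8

lemma card_tripleDet_normalInt_le : ∀ i j, i < j →
    (Finset.univ.filter fun k => (31 : ℤ) ∣ tripleDet (normalInt i) (normalInt j) (normalInt k)).card
      ≤ 7 := by
  decide +kernel

lemma card_tripleDet_normal_le {i j : Fin 27} (hij : i ≠ j) :
    (Finset.univ.filter fun k => tripleDet (normal i) (normal j) (normal k) = 0).card ≤ 7 := by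
  wlog h : i < j generalizing i j
  · refine le_of_eq_of_le ?_ (this hij.symm (lt_of_le_of_ne (not_lt.mp h) hij.symm))
    congr! 2 with k
    rw [← neg_eq_zero]
    congr! 1
    simp only [tripleDet]
    ring
  refine (Finset.card_le_card fun k hk => ?_).trans (card_tripleDet_normalInt_le i j h)
  simp only [Finset.mem_filter, Finset.mem_univ, true_and] at hk ⊢
  let φ : CycInt →+* ZMod 31 := CycInt.eval 2 (by decide)
  have hφ (l : Fin 27) : φ ∘ normal l = Int.castRingHom (ZMod 31) ∘ normalInt l := by
    funext m
    simp only [φ, Function.comp_apply, CycInt.eval_apply, normalInt, eq_intCast]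
    push_cast
    ring
  have h0 := congrArg φ hk
  rw [map_tripleDet, hφ, hφ, hφ, ← map_tripleDet, map_zero] at h0
  exact (ZMod.intCast_zmod_eq_zero_iff_dvd _ 31).mp h0

section Complex

variable {φ : CycInt →+* ℂ}

lemma comp_ne_zero (hφ : Function.Injective φ) {v : Fin 3 → CycInt} (hv : v ≠ 0) :
    φ ∘ v ≠ 0 := by
  obtain ⟨i, hi⟩ := Function.ne_iff.mp hv
  exact Function.ne_iff.mpr ⟨i, (map_ne_zero_iff φ hφ).mpr hi⟩

lemma perp_comp_eq_of_proportional (hφ : Function.Injective φ) {u v : Fin 3 → CycInt}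
    (h : Proportional u v) (hv : v ≠ 0) : perp (φ ∘ u) = perp (φ ∘ v) :=
  perp_eq_perp (comp_ne_zero hφ h.1) (comp_ne_zero hφ hv) fun i j => by
    simpa using congrArg φ (h.2 i j)

lemma finrank_perp_normal (hφ : Function.Injective φ) (i : Fin 27) :
    finrank ℂ (perp (φ ∘ normal i)) = 2 :=
  finrank_ker_of_ne_zero (lf_ne_zero (comp_ne_zero hφ (normal_ne_zero i)))

/-- A nonzero vector on two distinct planes lies on at most seven of the 27 planes. -/
lemma card_mem_perp_le (hφ : Function.Injective φ) {x : Fin 3 → ℂ} (hx : x ≠ 0) :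
    (Finset.univ.filter fun k => x ∈ perp (φ ∘ normal k)).card ≤ 7 := by
  by_contra! h
  obtain ⟨i, hi, j, hj, hij⟩ := Finset.one_lt_card.mp (lt_trans (by norm_num) h)
  refine h.not_ge ((Finset.card_le_card fun k hk => ?_).trans (card_tripleDet_normal_le hij))
  simp only [Finset.mem_filter, Finset.mem_univ, true_and] at hi hj hk ⊢
  rw [← map_eq_zero_iff φ hφ, map_tripleDet]
  exact tripleDet_eq_zero hx hi hj hk

lemma perp_normal_injective (hφ : Function.Injective φ) :
    Function.Injective fun i => perp (φ ∘ normal i) := by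
  intro i j hij
  by_contra hne
  have h := card_tripleDet_normal_le hne
  rw [Finset.filter_true_of_mem, Finset.card_univ, Fintype.card_fin] at h
  · omega
  intro k _
  have hk := finrank_inf_ge (finrank_perp_normal hφ i) (finrank_perp_normal hφ k)
  obtain ⟨x, hx, hx0⟩ := Submodule.exists_mem_ne_zero_of_ne_bot
    (p := perp (φ ∘ normal i) ⊓ perp (φ ∘ normal k)) (by rintro e; rw [e, finrank_bot] at hk; omega)
  rw [← map_eq_zero_iff φ hφ, map_tripleDet]
  exact tripleDet_eq_zero hx0 hx.1 (hij ▸ hx.1 : x ∈ (fun i => perp (φ ∘ normal i)) j) hx.2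

lemma exists_perp_reflect_eq (hφ : Function.Injective φ) {M : Matrix (Fin 3) (Fin 3) ℂ} {k : Fin 3}
    (hM : ∀ w, w ᵥ* M = reflect (φ tau) k w) {w : Fin 3 → ℂ}
    (hw : ∃ i, perp w = perp (φ ∘ normal i)) : ∃ i, perp (w ᵥ* M) = perp (φ ∘ normal i) := by
  obtain ⟨i, hi⟩ := hw
  obtain ⟨j, hj⟩ := exists_proportional_reflect i k
  refine ⟨j, ?_⟩
  rw [perp_vecMul, hi, ← perp_vecMul, hM, ← map_reflect]
  exact perp_comp_eq_of_proportional hφ hj (normal_ne_zero j)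

variable {G : Fin 3 → GL (Fin 3) ℂ}

/-- The group generated by the reflections permutes the 27 planes. -/
lemma exists_perp_vecMul_iff (hφ : Function.Injective φ)
    (hG : ∀ k w, w ᵥ* (G k : Matrix (Fin 3) (Fin 3) ℂ) = reflect (φ tau) k w)
    {g : GL (Fin 3) ℂ} (hg : g ∈ Subgroup.closure (Set.range G)) (w : Fin 3 → ℂ) :
    (∃ i, perp (w ᵥ* (g : Matrix (Fin 3) (Fin 3) ℂ)) = perp (φ ∘ normal i)) ↔
      ∃ i, perp w = perp (φ ∘ normal i) := by
  induction hg using Subgroup.closure_induction generalizing w with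
  | mem x hx =>
    obtain ⟨k, rfl⟩ := hx
    refine ⟨fun h => ?_, exists_perp_reflect_eq hφ (hG k)⟩
    simpa only [hG, reflect_reflect] using exists_perp_reflect_eq hφ (hG k) h
  | one => simp
  | mul x y _ _ hx hy => rw [Units.val_mul, ← Matrix.vecMul_vecMul, hy, hx]
  | inv x _ hx => rw [← hx, Matrix.vecMul_vecMul, ← Units.val_mul, inv_mul_cancel, Units.val_one,
      Matrix.vecMul_one]

/-- Each of the 27 planes is the orthogonal of a vector in any set that is stable under the
reflections and contains the first four normal vectors. -/
lemma perp_normal_mem_image (hφ : Function.Injective φ)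
    (hG : ∀ k w, w ᵥ* (G k : Matrix (Fin 3) (Fin 3) ℂ) = reflect (φ tau) k w)
    {R : Set (Fin 3 → ℂ)} (hR : ∀ w ∈ R, ∀ k, w ᵥ* (G k : Matrix (Fin 3) (Fin 3) ℂ) ∈ R)
    (hbase : ∀ i < 4, φ ∘ normal i ∈ R) (i : Fin 27) : perp (φ ∘ normal i) ∈ perp '' R := by
  induction i using WellFoundedLT.induction with
  | ind i ih =>
    obtain hi | hi := lt_or_ge i 4
    · exact ⟨_, hbase i hi, rfl⟩
    · obtain ⟨j, hj, k, hk⟩ := proportional_reflect_of_lt i hi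
      obtain ⟨w, hw, hwj⟩ := ih j hj
      refine ⟨_, hR w hw k, ?_⟩
      rw [perp_vecMul, hwj, ← perp_vecMul, hG, ← map_reflect]
      exact perp_comp_eq_of_proportional hφ hk (normal_ne_zero i)

end Complex

end Arrgt

open Arrgt in
/-- If a new hyperplane `H₀ ∉ 𝓐` contains no one-dimensional point of the intersection
lattice of the 27-hyperplane arrangement `𝓐`, then `(𝓐 ∪ {H₀})^{H₀}` has exactly 27
elements; if it contains exactly one such point `p`, then it has `27 - |𝓐_p| + 1 ≥ 21`
elements. -/
theorem H3A_added_hyperplane_restriction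
    (ζ : ℂ) (hζ : IsPrimitiveRoot ζ 5)
    (g1 g2 g3 : GL (Fin 3) ℂ)
    (hg1 : (g1 : Matrix (Fin 3) (Fin 3) ℂ) = !![1, 0, 0; 0, 1, 1; 0, 0, -1])
    (hg2 : (g2 : Matrix (Fin 3) (Fin 3) ℂ) = !![-1, 0, 0; -ζ^2 - ζ^3, 1, 0; 0, 0, 1])
    (hg3 : (g3 : Matrix (Fin 3) (Fin 3) ℂ) = !![1, -ζ^2 - ζ^3, 0; 0, -1, 0; 0, 1, 1])
    (W : Subgroup (GL (Fin 3) ℂ)) (hW : W = Subgroup.closure {g1, g2, g3})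
    (R : Set (Fin 3 → ℂ))
    (hR : R = {w | ∃ g ∈ W, ∃ i : Fin 3,
          w = Matrix.vecMul (Pi.single i 1) (g : Matrix (Fin 3) (Fin 3) ℂ)} ∪
        {w | ∃ g ∈ W, w = Matrix.vecMul ![1, -ζ^2, 0] (g : Matrix (Fin 3) (Fin 3) ℂ)})
    (𝓐 : Set (Submodule ℂ (Fin 3 → ℂ))) (h𝓐 : 𝓐 = Arrgt.perp '' R)
    (H₀ : Submodule ℂ (Fin 3 → ℂ)) (f : (Fin 3 → ℂ) →ₗ[ℂ] ℂ) (hf : f ≠ 0)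
    (hH₀ : H₀ = LinearMap.ker f) (hH₀A : H₀ ∉ 𝓐) :
    ({p ∈ setLattice 𝓐 | Module.finrank ℂ p = 1 ∧ p ≤ H₀} = ∅ →
        ((fun H' => H₀ ⊓ H') '' 𝓐).ncard = 27) ∧
      ∀ p₀, {p ∈ setLattice 𝓐 | Module.finrank ℂ p = 1 ∧ p ≤ H₀} = {p₀} →
        ((fun H' => H₀ ⊓ H') '' 𝓐).ncard = 27 - {H ∈ 𝓐 | p₀ ≤ H}.ncard + 1 ∧
          21 ≤ ((fun H' => H₀ ⊓ H') '' 𝓐).ncard := by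
  have hz : ζ ^ 4 + ζ ^ 3 + ζ ^ 2 + ζ + 1 = 0 := by
    have h := hζ.geom_sum_eq_zero (by norm_num)
    simp only [Finset.sum_range_succ, Finset.sum_range_zero] at h
    linear_combination h
  set φ := CycInt.eval ζ hz with hφ_def
  have hφ : Function.Injective φ := CycInt.eval_injective hζ hz
  have htau : φ tau = -ζ ^ 2 - ζ ^ 3 := by
    simp only [hφ_def, tau, CycInt.eval_apply]
    push_cast
    ring
  set G : Fin 3 → GL (Fin 3) ℂ := ![g1, g2, g3] with hG_def
  have hG (k : Fin 3) (w : Fin 3 → ℂ) :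
      w ᵥ* (G k : Matrix (Fin 3) (Fin 3) ℂ) = reflect (φ tau) k w := by
    rw [htau]
    funext i
    fin_cases k <;> fin_cases i <;>
      simp [hG_def, hg1, hg2, hg3, reflect, Matrix.vecMul, dotProduct, Fin.sum_univ_three] <;> ring
  have hW' : W = Subgroup.closure (Set.range G) := by
    rw [hW, hG_def, Matrix.range_cons, Matrix.range_cons, Matrix.range_cons, Matrix.range_empty,
      Set.union_empty, Set.singleton_union, Set.singleton_union]
  have hGW (k : Fin 3) : G k ∈ W := hW' ▸ Subgroup.subset_closure ⟨k, rfl⟩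
  have hnormal₀ (i : Fin 3) : φ ∘ normal (i.castLE (by norm_num)) = Pi.single i 1 := by
    funext j
    fin_cases i <;> fin_cases j <;>
      simp [hφ_def, normal, CycInt.eval_apply]
  have hnormal₃ : φ ∘ normal 3 = ![1, -ζ ^ 2, 0] := by
    funext j
    fin_cases j <;> simp [hφ_def, normal, CycInt.eval_apply]
  have hRmul : ∀ w ∈ R, ∀ k, w ᵥ* (G k : Matrix (Fin 3) (Fin 3) ℂ) ∈ R := by
    rw [hR]
    rintro _ (⟨g, hg, i, rfl⟩ | ⟨g, hg, rfl⟩) k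
    · exact Or.inl ⟨g * G k, W.mul_mem hg (hGW k), i, by
        rw [Units.val_mul, Matrix.vecMul_vecMul]⟩
    · exact Or.inr ⟨g * G k, W.mul_mem hg (hGW k), by
        rw [Units.val_mul, Matrix.vecMul_vecMul]⟩
  have hbase₀ (i : Fin 3) : φ ∘ normal (i.castLE (by norm_num)) ∈ R := by
    rw [hR]
    exact Or.inl ⟨1, W.one_mem, i, by rw [Units.val_one, Matrix.vecMul_one, hnormal₀]⟩
  have hbase₃ : φ ∘ normal 3 ∈ R := by
    rw [hR]
    exact Or.inr ⟨1, W.one_mem, by rw [Units.val_one, Matrix.vecMul_one, hnormal₃]⟩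
  have hbase : ∀ i < 4, φ ∘ normal i ∈ R := by
    intro i hi
    obtain h | h := lt_or_ge i 3
    · exact hbase₀ ⟨i, h⟩
    · obtain rfl : i = 3 := le_antisymm (Fin.le_def.mpr (Nat.le_of_lt_succ hi)) h
      exact hbase₃
  have hrange : 𝓐 = Set.range fun i => perp (φ ∘ normal i) := by
    rw [h𝓐]
    refine subset_antisymm ?_ ?_
    · suffices h : ∀ w ∈ R, ∃ i, perp w = perp (φ ∘ normal i) by
        rintro _ ⟨w, hw, rfl⟩
        obtain ⟨i, hi⟩ := h w hw
        exact ⟨i, hi.symm⟩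
      rw [hR, hW']
      rintro _ (⟨g, hg, i, rfl⟩ | ⟨g, hg, rfl⟩)
      · exact (exists_perp_vecMul_iff hφ hG hg _).mpr ⟨_, by rw [← hnormal₀ i]⟩
      · exact (exists_perp_vecMul_iff hφ hG hg _).mpr ⟨3, by rw [hnormal₃]⟩
    · rintro _ ⟨i, rfl⟩
      exact perp_normal_mem_image hφ hG hRmul hbase i
  have hfin : 𝓐.Finite := hrange ▸ Set.finite_range _
  have hcard : 𝓐.ncard = 27 := by
    rw [hrange, ← Set.image_univ, Set.ncard_image_of_injective _ (perp_normal_injective hφ),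
      Set.ncard_univ, Nat.card_eq_fintype_card, Fintype.card_fin]
  have hrank : ∀ H ∈ 𝓐, finrank ℂ H = 2 := by
    rw [hrange]
    rintro _ ⟨i, rfl⟩
    exact finrank_perp_normal hφ i
  have h₀ : finrank ℂ H₀ = 2 := hH₀ ▸ finrank_ker_of_ne_zero hf
  refine ⟨fun hp => (ncard_trace_of_no_point hrank h₀ hH₀A hp).trans hcard, fun p₀ hp => ?_⟩
  have hcount := ncard_trace_of_unique_point hfin hrank h₀ hH₀A hp
  rw [hcard] at hcount
  refine ⟨hcount, ?_⟩
  have hp1 : finrank ℂ p₀ = 1 :=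
    (hp ▸ rfl : p₀ ∈ {p ∈ setLattice 𝓐 | finrank ℂ p = 1 ∧ p ≤ H₀}).2.1
  obtain ⟨x, hx, hx0⟩ := Submodule.exists_mem_ne_zero_of_ne_bot (p := p₀)
    (by rintro rfl; rw [finrank_bot] at hp1; omega)
  have hsub : {H ∈ 𝓐 | p₀ ≤ H} ⊆ (fun i => perp (φ ∘ normal i)) ''
      (Finset.univ.filter fun k => x ∈ perp (φ ∘ normal k) : Finset (Fin 27)) := by
    rintro H ⟨hH, hle⟩
    rw [hrange] at hH
    obtain ⟨i, rfl⟩ := hH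
    exact ⟨i, by simpa using hle hx, rfl⟩
  have hle := (Set.ncard_le_ncard hsub (Set.toFinite _)).trans
    ((Set.ncard_image_le (Set.toFinite _)).trans_eq (Set.ncard_coe_finset _))
  have h7 := card_mem_perp_le hφ hx0
  omega
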